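/- Let A ↪ T be an integral extension where A is a Noetherian integral domain and T is an integral domain, and let x ∈ A be a nonzero element that is a non-zerodivisor on T. Then T is integrally closed in T[1/x] if and only if T is completely integrally closed in T[1/x]. -/

import Mathlib

/-- In a Noetherian domain, if `P` is a minimal prime over `(z)` and `c ≠ 0`, then some power of
`z` becomes a multiple of `c` after localizing at `P`. -/
theorem Ideal.exists_notMem_mul_pow_mem_span_of_mem_minimalPrimes
    {C : Type*} [CommRing C] [IsDomain C] [IsNoetherianRing C] {c z : C} (hc : c ≠ 0)
    {P : Ideal C} (hP : P ∈ (Ideal.span {z}).minimalPrimes) :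
    ∃ s ∉ P, ∃ n : ℕ, s * z ^ n ∈ Ideal.span {c} := by
  have hPprime : P.IsPrime := hP.isPrime
  have hzP : z ∈ P := hP.1.2 (Ideal.mem_span_singleton_self z)
  by_contra! h
  obtain ⟨Q, hQ, hcQ, hdisj⟩ := Ideal.exists_le_prime_disjoint (Ideal.span {c})
    (P.primeCompl ⊔ Submonoid.powers z) (by
      rw [Set.disjoint_right]
      intro a ha hac
      obtain ⟨s, hs, w, ⟨n, rfl⟩, rfl⟩ := Submonoid.mem_sup.1 ha
      exact h s hs n hac)
  rw [Set.disjoint_left] at hdisj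
  have hQP : Q < P := by
    refine lt_of_le_not_ge (fun q hq ↦ ?_) fun hPQ ↦ ?_
    · by_contra hqP
      exact hdisj hq (Submonoid.mem_sup_left hqP)
    · exact hdisj (hPQ hzP) (Submonoid.mem_sup_right (Submonoid.mem_powers z))
  have hQ0 : ⊥ < Q :=
    bot_lt_iff_ne_bot.2 fun hQ0 ↦ hc (by simpa [hQ0] using hcQ)
  have hQheight := Ideal.height_add_one_le_of_lt_of_isPrime hQ0
  have hPheight := Ideal.height_add_one_le_of_lt_of_isPrime hQP
  have hle := Ideal.height_le_one_of_isPrincipal_of_mem_minimalPrimes _ P hP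
  rw [Ideal.height_bot, zero_add] at hQheight
  have := (add_le_add_left hQheight 1).trans (hPheight.trans hle)
  norm_num at this

/-- Over a Noetherian domain `A`, an element `y` of an extension field is integral as soon as
all `c * y ^ n` are integral for a fixed nonzero `c` in `A`. -/
theorem isIntegral_of_forall_isIntegral_mul_pow
    {A L : Type*} [CommRing A] [IsNoetherianRing A] [Field L] [Algebra A L]
    {c : A} (hc : algebraMap A L c ≠ 0) {y : L}
    (h : ∀ n : ℕ, 0 < n → IsIntegral A (algebraMap A L c * y ^ n)) :
    IsIntegral A y := by
  obtain rfl | hy := eq_or_ne y 0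
  · exact isIntegral_zero
  let C := Algebra.adjoin A {y⁻¹}
  have : IsNoetherianRing C := isNoetherianRing_of_fg ⟨{y⁻¹}, by simp [C]⟩
  let z : C := ⟨y⁻¹, Algebra.self_mem_adjoin_singleton A _⟩
  by_cases hz : IsUnit z
  · have := (algebraMap A L).domain_nontrivial
    let := invertibleOfNonzero (inv_ne_zero hy)
    obtain ⟨p, hp, hpy⟩ :=
      Algebra.exists_aeval_invOf_eq_zero_of_idealMap_adjoin_sup_span_eq_top y⁻¹
        (⊥ : Ideal A) bot_ne_top
        (top_unique ((Ideal.span_singleton_eq_top.2 hz).ge.trans le_sup_right))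
    exact ⟨p, by simpa [Polynomial.Monic, sub_eq_zero] using hp,
      by simpa [Polynomial.aeval_def] using hpy⟩
  exfalso
  obtain ⟨P, hP⟩ := Ideal.nonempty_minimalPrimes (I := Ideal.span {z})
    (by rwa [Ne, Ideal.span_singleton_eq_top])
  have hPprime : P.IsPrime := hP.isPrime
  have hzP : z ∈ P := hP.1.2 (Ideal.mem_span_singleton_self z)
  have hcC : algebraMap A C c ≠ 0 := fun h0 ↦ hc (by
    rw [IsScalarTower.algebraMap_apply A C L, h0, map_zero])
  obtain ⟨s, hs, n, hsn⟩ :=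
    Ideal.exists_notMem_mul_pow_mem_span_of_mem_minimalPrimes hcC hP
  obtain ⟨r, hr⟩ := Ideal.mem_span_singleton'.1 hsn
  have hr' : (r : L) * algebraMap A L c = s * y⁻¹ ^ n := congrArg Subtype.val hr
  have hsy : IsIntegral C ((s : L) * y) := by
    have hw : IsIntegral C ((r : L) * (algebraMap A L c * y ^ (n + 1))) :=
      (isIntegral_algebraMap (x := r)).mul (h (n + 1) n.succ_pos).tower_top
    convert hw using 1
    rw [← mul_assoc, hr', inv_pow, pow_succ]
    field_simp
  obtain ⟨Q, -, hQ, hQP⟩ := Ideal.exists_ideal_over_prime_of_isIntegral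
    (S := integralClosure C L) P ⊥ (by
      intro a ha
      have ha0 : (a : L) = 0 := congrArg Subtype.val (Ideal.mem_bot.1 (Ideal.mem_comap.1 ha))
      have ha0' : a = 0 := Subtype.ext ha0
      exact ha0' ▸ P.zero_mem)
  apply hs
  rw [← hQP] at hzP ⊢
  rw [Ideal.mem_comap] at hzP ⊢
  have hmul : algebraMap C (integralClosure C L) s =
      algebraMap C (integralClosure C L) z * ⟨(s : L) * y, hsy⟩ := by
    apply Subtype.ext
    change (s : L) = y⁻¹ * (s * y)
    field_simp
  rw [hmul]
  exact Q.mul_mem_right _ hzP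

/-- An integral element of a localization has all its powers cleared by a common denominator. -/
theorem IsIntegral.exists_forall_mul_pow_mem_range_of_isLocalization
    {T S : Type*} [CommRing T] [CommRing S] [Algebra T S] (M : Submonoid T) [IsLocalization M S]
    {y : S} (hy : IsIntegral T y) :
    ∃ b ∈ M, ∀ n : ℕ, algebraMap T S b * y ^ n ∈ (algebraMap T S).range := by
  obtain ⟨F, hF⟩ := hy.fg_adjoin_singleton
  obtain ⟨b, hb⟩ := IsLocalization.exist_integer_multiples_of_finset M F
  refine ⟨b, b.2, fun n ↦ ?_⟩
  have hle : Submodule.span T (F : Set S) ≤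
      (LinearMap.range (Algebra.linearMap T S)).comap (LinearMap.mulLeft T (algebraMap T S b)) :=
    Submodule.span_le.2 fun a ha ↦ by
      obtain ⟨t, ht⟩ := hb a ha
      exact ⟨t, by simpa [Algebra.smul_def] using ht⟩
  rw [hF] at hle
  exact hle (pow_mem (Algebra.self_mem_adjoin_singleton T y) n)

/-- Let `A ↪ T` be an integral extension with `A` a Noetherian domain and `T` a
domain, and let `x ∈ A` be a nonzero element that is a non-zerodivisor on `T`.  Then `T` is
integrally closed in `T[1/x]` if and only if `T` is completely integrally closed in `T[1/x]`. -/
theorem integrally_closed_iff_completely_integrally_closed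
    (A T : Type*) [CommRing A] [IsDomain A] [IsNoetherianRing A]
    [CommRing T] [IsDomain T] [Algebra A T]
    (hinj : Function.Injective (algebraMap A T)) [Algebra.IsIntegral A T]
    (x : A) (hx : x ≠ 0) (hreg : algebraMap A T x ∈ nonZeroDivisors T)
    (S : Type*) [CommRing S] [Algebra T S] [IsLocalization.Away (algebraMap A T x) S] :
    (∀ y : S, IsIntegral T y → y ∈ (algebraMap T S).range) ↔
      (∀ y : S,
        (∃ m : ℕ, ∀ n : ℕ, 0 < n →
          algebraMap T S (algebraMap A T x) ^ m * y ^ n ∈ (algebraMap T S).range) →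
        y ∈ (algebraMap T S).range) := by
  constructor
  · rintro h y ⟨m, hm⟩
    apply h
    have hM : Submonoid.powers (algebraMap A T x) ≤ nonZeroDivisors T := by
      rwa [Submonoid.powers_le]
    have : IsDomain S := IsLocalization.isDomain_of_le_nonZeroDivisors S hM
    have hTS : Function.Injective (algebraMap T S) := IsLocalization.injective S hM
    let : Algebra A S := ((algebraMap T S).comp (algebraMap A T)).toAlgebra
    have : IsScalarTower A T S := IsScalarTower.of_algebraMap_eq fun _ ↦ rfl
    have hinjL : Function.Injective (algebraMap S (FractionRing S)) :=
      IsFractionRing.injective S (FractionRing S)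
    have hAL (a : A) : algebraMap A (FractionRing S) a =
        algebraMap S (FractionRing S) (algebraMap T S (algebraMap A T a)) := by
      rw [IsScalarTower.algebraMap_apply A S (FractionRing S),
        IsScalarTower.algebraMap_apply A T S]
    have hint : IsIntegral A (algebraMap S (FractionRing S) y) := by
      refine isIntegral_of_forall_isIntegral_mul_pow (c := x ^ m) ?_ fun n hn ↦ ?_
      · rw [hAL]
        exact (map_ne_zero_iff _ hinjL).2 ((map_ne_zero_iff _ hTS).2
          ((map_ne_zero_iff _ hinj).2 (pow_ne_zero m hx)))
      · obtain ⟨t, ht⟩ := hm n hn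
        rw [hAL, map_pow, map_pow, ← map_pow (algebraMap S _) y, ← map_mul, ← ht]
        exact ((Algebra.IsIntegral.isIntegral (R := A) t).algebraMap (B := S)).algebraMap
    exact ((isIntegral_algebraMap_iff hinjL).1 hint).tower_top
  · intro h y hy
    obtain ⟨_, ⟨m, rfl⟩, hm⟩ := hy.exists_forall_mul_pow_mem_range_of_isLocalization
      (Submonoid.powers (algebraMap A T x))
    exact h y ⟨m, fun n _ ↦ by simpa using hm n⟩
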